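/- For every composition α of n, the ribbon Schur function satisfies MacMahon's alternating formula r_α(x) = Σ_{β ⪯ α} (-1)^{ℓ(α) - ℓ(β)} h_β(x), where the sum is over all compositions β of n coarser than α in reverse refinement order. -/

import Mathlib

/-- Auxiliary construction of the cells of a ribbon: each part of the list
contributes a row, rows are read from bottom to top (in English (row, column)
coordinates the row coordinate decreases as we go up), and each new row starts
in the column of the last cell of the previous row. -/
def ribbonAux : List ℕ → ℤ × ℤ → Finset (ℤ × ℤ)
  | [], _ => ∅
  | a :: rest, p =>
      ((Finset.range a).image fun j : ℕ => (p.1, p.2 + (j : ℤ))) ∪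
        ribbonAux rest (p.1 - 1, p.2 + (a : ℤ) - 1)

/-- The cells of the ribbon (zigzag diagram) whose row lengths, read from
bottom to top, are the entries of `l`. -/
def ribbonOfList (l : List ℕ) : Finset (ℤ × ℤ) := ribbonAux l (0, 0)
/-- The (skew) Schur function of the shape with cell set `D`, as the generating
function of semistandard Young tableaux of shape `D`: fillings of `D` that
weakly increase along rows and strictly increase down columns. -/
noncomputable def skewSchur (D : Finset (ℤ × ℤ)) : MvPowerSeries ℕ ℤ := fun d =>
  (({T : ℤ × ℤ → ℕ |
      (∀ c ∉ D, T c = 0) ∧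
      (∀ c ∈ D, (c.1, c.2 + 1) ∈ D → T c ≤ T (c.1, c.2 + 1)) ∧
      (∀ c ∈ D, (c.1 + 1, c.2) ∈ D → T c < T (c.1 + 1, c.2)) ∧
      (∑ c ∈ D, Finsupp.single (T c) 1) = d}).ncard : ℤ)

/-- The complete homogeneous symmetric function `h_m` in the variables
`x_0, x_1, …`. -/
noncomputable def hPS (m : ℕ) : MvPowerSeries ℕ ℤ := fun d =>
  (({i : Fin m → ℕ | Monotone i ∧ (∑ t : Fin m, Finsupp.single (i t) 1) = d}).ncard : ℤ)

/-- `h_β = h_{β₁} h_{β₂} ⋯` for a composition `β` given by its list of parts. -/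
noncomputable def hComp (l : List ℕ) : MvPowerSeries ℕ ℤ := (l.map hPS).prod

/-- The set of partial sums of the list `l`, excluding the total sum:
for a composition `α` of `n` this is the set `S_α ⊆ [n-1]`. -/
def innerSums (l : List ℕ) : Set ℕ :=
  {m | ∃ k, k + 1 < l.length ∧ m = (l.take (k + 1)).sum}

section

open Finset

/-- The exponent vector of the monomial `x_{w₁} x_{w₂} ⋯` attached to a word `w`. -/
noncomputable def wordWeight (w : List ℕ) : ℕ →₀ ℕ := (w.map fun x => Finsupp.single x 1).sum

theorem wordWeight_append (u v : List ℕ) : wordWeight (u ++ v) = wordWeight u + wordWeight v := by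
  simp [wordWeight]

theorem wordWeight_apply (w : List ℕ) (x : ℕ) : wordWeight w x = w.count x := by
  induction w with
  | nil => simp [wordWeight]
  | cons a w ih =>
    rw [wordWeight] at ih
    rw [wordWeight, List.map_cons, List.sum_cons, Finsupp.add_apply, ih, List.count_cons,
      Finsupp.single_apply, add_comm]
    simp

theorem finite_wordWeight_eq (d : ℕ →₀ ℕ) : {w | wordWeight w = d}.Finite := by
  rcases Set.eq_empty_or_nonempty {w | wordWeight w = d} with h | ⟨v, hv⟩
  · simp [h]
  · refine v.permutations.finite_toSet.subset fun w hw => ?_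
    simp only [Set.mem_ofPred_eq, List.mem_permutations, List.perm_iff_count] at *
    intro x
    rw [← wordWeight_apply, ← wordWeight_apply, hw, hv]

/-- The finite set of words of weight `d`. -/
noncomputable def wordsOfWeight (d : ℕ →₀ ℕ) : Finset (List ℕ) := (finite_wordWeight_eq d).toFinset

theorem mem_wordsOfWeight {d : ℕ →₀ ℕ} {w : List ℕ} : w ∈ wordsOfWeight d ↔ wordWeight w = d := by
  simp [wordsOfWeight]

open Classical in
/-- The generating function of a set of words. -/
noncomputable def wordSeries (S : Set (List ℕ)) : MvPowerSeries ℕ ℤ := fun d =>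
  (#{w ∈ wordsOfWeight d | w ∈ S} : ℤ)

theorem wordSeries_apply (S : Set (List ℕ)) (d : ℕ →₀ ℕ) :
    wordSeries S d = (({w | w ∈ S ∧ wordWeight w = d}).ncard : ℤ) := by
  classical
  rw [wordSeries, ← Set.ncard_coe_finset]
  congr 2
  ext w
  simp [mem_wordsOfWeight, and_comm]

theorem wordSeries_mul {a : ℕ} {S T U : Set (List ℕ)} (hS : ∀ u ∈ S, u.length = a)
    (hU : ∀ w, w ∈ U ↔ w.take a ∈ S ∧ w.drop a ∈ T) :
    wordSeries U = wordSeries S * wordSeries T := by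
  classical
  ext d
  rw [MvPowerSeries.coeff_mul]
  change ((#{w ∈ wordsOfWeight d | w ∈ U} : ℕ) : ℤ) = ∑ p ∈ antidiagonal d,
    ((#{w ∈ wordsOfWeight p.1 | w ∈ S} : ℕ) : ℤ) * ((#{w ∈ wordsOfWeight p.2 | w ∈ T} : ℕ) : ℤ)
  rw [card_eq_sum_card_fiberwise (t := antidiagonal d)
    (f := fun w => (wordWeight (w.take a), wordWeight (w.drop a)))]
  · push_cast
    refine sum_congr rfl fun p hp => ?_
    rw [← Nat.cast_mul, ← card_product]
    congr 1
    refine card_bij' (fun w _ => (w.take a, w.drop a)) (fun q _ => q.1 ++ q.2) ?_ ?_ ?_ ?_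
    · intro w hw
      simp only [mem_filter, mem_wordsOfWeight, hU, Prod.ext_iff, mem_product] at hw ⊢
      tauto
    · intro q hq
      simp only [mem_filter, mem_wordsOfWeight, hU, Prod.ext_iff, mem_product] at hq ⊢
      obtain ⟨⟨h1, h2⟩, h3, h4⟩ := hq
      rw [HasAntidiagonal.mem_antidiagonal] at hp
      have hl := hS _ h2
      rw [wordWeight_append, List.take_left' hl, List.drop_left' hl, h1, h3]
      exact ⟨⟨hp, h2, h4⟩, rfl, rfl⟩
    · intro w _
      simp
    · intro q hq
      simp only [mem_product, mem_filter] at hq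
      simp [← hS _ hq.1.2]
  · intro w hw
    simp only [coe_filter, mem_wordsOfWeight, Set.mem_ofPred_eq] at hw
    simp [← wordWeight_append, hw.1]

/-- The descent set of a word, a descent being recorded by the position following it. -/
def descents (w : List ℕ) : Set ℕ :=
  {m | ∃ i, m = i + 1 ∧ i + 1 < w.length ∧ w.getD (i + 1) 0 < w.getD i 0}

theorem descents_subset_iff {w : List ℕ} {S : Set ℕ} : descents w ⊆ S ↔
    ∀ i, i + 1 < w.length → i + 1 ∉ S → w.getD i 0 ≤ w.getD (i + 1) 0 := by
  constructor
  · intro h i hi hS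
    by_contra! hlt
    exact hS (h ⟨i, rfl, hi, hlt⟩)
  · rintro h _ ⟨i, rfl, hi, hlt⟩
    by_contra hS
    exact absurd (h i hi hS) (by omega)

theorem innerSums_nil : innerSums [] = ∅ := by
  ext m; simp [innerSums]

theorem mem_innerSums_cons {a m : ℕ} {l : List ℕ} :
    m ∈ innerSums (a :: l) ↔ (m = a ∧ l ≠ []) ∨ ∃ k ∈ innerSums l, m = a + k := by
  constructor
  · rintro ⟨k, hk, rfl⟩
    cases k with
    | zero =>
      left
      simpa [List.length_pos_iff] using hk
    | succ k => exact .inr ⟨_, ⟨k, by simpa using hk, rfl⟩, by simp⟩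
  · rintro (⟨rfl, hl⟩ | ⟨_, ⟨k, hk, rfl⟩, rfl⟩)
    · exact ⟨0, by simpa [List.length_pos_iff] using hl, by simp⟩
    · exact ⟨k + 1, by simpa using hk, by simp⟩

theorem innerSums_bounds {l : List ℕ} (hl : ∀ a ∈ l, 0 < a) {m : ℕ} (hm : m ∈ innerSums l) :
    0 < m ∧ m < l.sum := by
  induction l generalizing m with
  | nil => simp [innerSums_nil] at hm
  | cons a l ih =>
    simp only [List.forall_mem_cons] at hl
    rw [List.sum_cons]
    rcases mem_innerSums_cons.1 hm with ⟨rfl, h⟩ | ⟨k, hk, rfl⟩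
    · have := List.sum_pos l hl.2 h
      omega
    · have := ih hl.2 hk
      omega

theorem hPS_eq_wordSeries (m : ℕ) :
    hPS m = wordSeries {w | w.length = m ∧ descents w ⊆ ∅} := by
  ext d
  change hPS m d = wordSeries _ d
  rw [wordSeries_apply, hPS]
  congr 1
  refine Set.ncard_congr (fun i _ => List.ofFn i) ?_ ?_ ?_
  · rintro i ⟨hi, hd⟩
    refine ⟨⟨by simp, descents_subset_iff.2 fun j hj _ => ?_⟩, ?_⟩
    · rw [List.getD_eq_getElem _ _ hj, List.getD_eq_getElem _ _ (by omega)]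
      simpa using hi (by simp)
    · rw [wordWeight, List.map_ofFn, List.sum_ofFn]
      exact hd
  · intro i j _ _ h
    exact List.ofFn_injective h
  · rintro w ⟨⟨rfl, hw⟩, hd⟩
    refine ⟨w.get, ⟨?_, ?_⟩, List.ofFn_get w⟩
    · have key : ∀ i j, i ≤ j → j < w.length → w.getD i 0 ≤ w.getD j 0 := by
        intro i j hij
        induction j, hij using Nat.le_induction with
        | base => simp
        | succ j hij ih =>
          intro hj
          exact (ih (by omega)).trans (descents_subset_iff.1 hw j hj (by simp))
      intro i j hij
      have := key i j hij j.2
      rwa [List.getD_eq_getElem _ _ i.2, List.getD_eq_getElem _ _ j.2] at this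
    · rw [← hd, wordWeight, ← List.sum_ofFn]
      conv_rhs => rw [← List.ofFn_get w, List.map_ofFn]
      rfl

theorem hComp_eq_wordSeries {l : List ℕ} (hl : ∀ a ∈ l, 0 < a) :
    hComp l = wordSeries {w | w.length = l.sum ∧ descents w ⊆ innerSums l} := by
  induction l with
  | nil =>
    classical
    ext d
    change (1 : MvPowerSeries ℕ ℤ).coeff d = wordSeries _ d
    rw [wordSeries_apply, MvPowerSeries.coeff_one]
    have : {w | w ∈ {w : List ℕ | w.length = [].sum ∧ descents w ⊆ innerSums []} ∧
        wordWeight w = d} = if d = 0 then {[]} else ∅ := by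
      ext w
      simp only [List.sum_nil, List.length_eq_zero_iff, Set.mem_ofPred_eq]
      split_ifs with h
      · subst h
        simp only [Set.mem_singleton_iff]
        refine ⟨fun h => h.1.1, ?_⟩
        rintro rfl
        exact ⟨⟨rfl, descents_subset_iff.2 (by simp)⟩, by simp [wordWeight]⟩
      · simp only [Set.mem_empty_iff_false, iff_false]
        rintro ⟨⟨rfl, -⟩, h2⟩
        exact h (by simpa [wordWeight] using h2.symm)
    rw [this]
    split_ifs <;> simp
  | cons a l ih =>
    simp only [List.forall_mem_cons] at hl
    have hcomp : hComp (a :: l) = hPS a * hComp l := by simp [hComp]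
    rw [hcomp, ih hl.2, hPS_eq_wordSeries]
    refine (wordSeries_mul (a := a) (fun u hu => hu.1) fun w => ?_).symm
    simp only [Set.mem_ofPred_eq, descents_subset_iff, List.length_take, List.length_drop,
      List.sum_cons]
    have hsum : l = [] → l.sum = 0 := by rintro rfl; rfl
    have htake : ∀ i < a, (w.take a).getD i 0 = w.getD i 0 := by
      intro i hi
      simp [List.getD_eq_getElem?_getD, hi]
    have hdrop : ∀ i, (w.drop a).getD i 0 = w.getD (a + i) 0 := by
      intro i
      simp [List.getD_eq_getElem?_getD]
    constructor
    · rintro ⟨hlen, h⟩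
      refine ⟨⟨by omega, fun i hi _ => ?_⟩, by omega, fun i hi hin => ?_⟩
      · rw [htake _ (by omega), htake _ (by omega)]
        refine h i (by omega) fun hm => ?_
        rcases mem_innerSums_cons.1 hm with ⟨h1, -⟩ | ⟨k, -, h1⟩ <;> omega
      · rw [hdrop, hdrop]
        refine h (a + i) (by omega) fun hm => ?_
        rcases mem_innerSums_cons.1 hm with ⟨h1, -⟩ | ⟨k, hk, h1⟩
        · omega
        · obtain rfl : k = i + 1 := by omega
          exact hin hk
    · rintro ⟨⟨h1, h2⟩, h3, h4⟩
      refine ⟨?_, fun i hi hin => ?_⟩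
      · omega
      · rcases lt_trichotomy (i + 1) a with hia | hia | hia
        · have := h2 i (by omega) (by simp)
          rwa [htake _ (by omega), htake _ (by omega)] at this
        · refine absurd (mem_innerSums_cons.2 (.inl ⟨hia, ?_⟩)) hin
          intro h0
          have := hsum h0
          omega
        · obtain ⟨k, rfl⟩ : ∃ k, i = a + k := ⟨i - a, by omega⟩
          have := h4 k (by omega) fun hk => hin (mem_innerSums_cons.2 (.inr ⟨_, hk, rfl⟩))
          rwa [hdrop, hdrop] at this

/-- The `i`-th cell of the ribbon with row lengths `l` starting at `p`, reading rows from bottom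
to top and each row from left to right. -/
def ribbonCell : List ℕ → ℤ × ℤ → ℕ → ℤ × ℤ
  | [], p, _ => p
  | a :: l, p, i =>
      if i < a then (p.1, p.2 + i) else ribbonCell l (p.1 - 1, p.2 + a - 1) (i - a)

theorem mem_ribbonAux {l : List ℕ} {p c : ℤ × ℤ} :
    c ∈ ribbonAux l p ↔ ∃ i < l.sum, ribbonCell l p i = c := by
  induction l generalizing p with
  | nil => simp [ribbonAux]
  | cons a l ih =>
    simp only [ribbonAux, mem_union, mem_image, mem_range, ih, List.sum_cons, ribbonCell]
    constructor
    · rintro (⟨j, hj, rfl⟩ | ⟨i, hi, rfl⟩)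
      · exact ⟨j, by omega, by simp [hj]⟩
      · exact ⟨a + i, by omega, by simp⟩
    · rintro ⟨i, hi, rfl⟩
      split_ifs with h
      · exact .inl ⟨i, h, rfl⟩
      · exact .inr ⟨i - a, by omega, rfl⟩

theorem content_ribbonCell {l : List ℕ} {p : ℤ × ℤ} {i : ℕ} (hi : i < l.sum) :
    (ribbonCell l p i).2 - (ribbonCell l p i).1 = p.2 - p.1 + i := by
  induction l generalizing p i with
  | nil => simp at hi
  | cons a l ih =>
    rw [List.sum_cons] at hi
    rw [ribbonCell]
    split_ifs with h
    · dsimp only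
      ring
    · rw [ih (by omega)]
      push_cast [not_lt.1 h]
      ring

theorem ribbonCell_injOn (l : List ℕ) (p : ℤ × ℤ) : Set.InjOn (ribbonCell l p) (range l.sum) := by
  intro i hi j hj h
  have h1 := content_ribbonCell (p := p) (by simpa using hi)
  have h2 := content_ribbonCell (p := p) (by simpa using hj)
  rw [h] at h1
  omega

theorem ribbonCell_zero {l : List ℕ} (hl : ∀ a ∈ l, 0 < a) (p : ℤ × ℤ) : ribbonCell l p 0 = p := by
  cases l with
  | nil => rfl
  | cons a l => simp [ribbonCell, hl a]

theorem ribbonCell_succ {l : List ℕ} (hl : ∀ a ∈ l, 0 < a) {p : ℤ × ℤ} {i : ℕ}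
    (hi : i + 1 < l.sum) :
    (i + 1 ∈ innerSums l →
      ribbonCell l p (i + 1) = ((ribbonCell l p i).1 - 1, (ribbonCell l p i).2)) ∧
    (i + 1 ∉ innerSums l →
      ribbonCell l p (i + 1) = ((ribbonCell l p i).1, (ribbonCell l p i).2 + 1)) := by
  induction l generalizing p i with
  | nil => simp at hi
  | cons a l ih =>
    simp only [List.forall_mem_cons] at hl
    rw [List.sum_cons] at hi
    have hlast : l ≠ [] ∨ i + 1 < a := by
      by_contra! h
      obtain ⟨rfl, h⟩ := h
      rw [List.sum_nil] at hi
      omega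
    rcases lt_trichotomy (i + 1) a with h | h | h
    · refine ⟨fun hm => ?_, fun _ => ?_⟩
      · rcases mem_innerSums_cons.1 hm with ⟨h1, -⟩ | ⟨k, -, h1⟩ <;> omega
      · simp only [ribbonCell, h, if_true, show i < a by omega]
        push_cast
        ring_nf
    · refine ⟨fun _ => ?_, fun hm => ?_⟩
      · simp only [ribbonCell, h, lt_irrefl, if_false, show i < a by omega, if_true, Nat.sub_self,
          ribbonCell_zero hl.2]
        rw [← h]
        push_cast
        ring_nf
      · exact absurd (mem_innerSums_cons.2 (.inl ⟨h, hlast.resolve_right (by omega)⟩)) hm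
    · obtain ⟨k, rfl⟩ : ∃ k, i = a + k := ⟨i - a, by omega⟩
      have hmem : a + k + 1 ∈ innerSums (a :: l) ↔ k + 1 ∈ innerSums l := by
        rw [mem_innerSums_cons]
        constructor
        · rintro (⟨h1, -⟩ | ⟨m, hm, h1⟩)
          · omega
          · obtain rfl : m = k + 1 := by omega
            exact hm
        · exact fun hk => .inr ⟨_, hk, by omega⟩
      have hsucc : ribbonCell (a :: l) p (a + k + 1) =
          ribbonCell l (p.1 - 1, p.2 + a - 1) (k + 1) := by
        simp [ribbonCell, add_assoc]
      have hself : ribbonCell (a :: l) p (a + k) = ribbonCell l (p.1 - 1, p.2 + a - 1) k := by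
        simp [ribbonCell]
      rw [hmem, hsucc, hself]
      exact ih hl.2 (by omega)

theorem descents_eq_iff {w : List ℕ} {S : Set ℕ} (hS : ∀ m ∈ S, 0 < m ∧ m < w.length) :
    descents w = S ↔ ∀ i, i + 1 < w.length →
      (i + 1 ∈ S → w.getD (i + 1) 0 < w.getD i 0) ∧
      (i + 1 ∉ S → w.getD i 0 ≤ w.getD (i + 1) 0) := by
  rw [Set.Subset.antisymm_iff, descents_subset_iff]
  constructor
  · rintro ⟨h1, h2⟩ i hi
    refine ⟨fun hm => ?_, h1 i hi⟩
    obtain ⟨j, hj, -, hlt⟩ := h2 hm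
    obtain rfl : i = j := by omega
    exact hlt
  · refine fun h => ⟨fun i hi => (h i hi).2, fun m hm => ?_⟩
    obtain ⟨h0, hlt⟩ := hS m hm
    obtain ⟨i, rfl⟩ : ∃ i, m = i + 1 := ⟨m - 1, by omega⟩
    exact ⟨i, rfl, hlt, (h i hlt).1 hm⟩

theorem ribbon_semistandard_iff {l : List ℕ} (hl : ∀ a ∈ l, 0 < a) (T : ℤ × ℤ → ℕ) :
    ((∀ c ∈ ribbonOfList l, (c.1, c.2 + 1) ∈ ribbonOfList l → T c ≤ T (c.1, c.2 + 1)) ∧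
      (∀ c ∈ ribbonOfList l, (c.1 + 1, c.2) ∈ ribbonOfList l → T c < T (c.1 + 1, c.2))) ↔
    ∀ i, i + 1 < l.sum →
      (i + 1 ∈ innerSums l → T (ribbonCell l (0, 0) (i + 1)) < T (ribbonCell l (0, 0) i)) ∧
      (i + 1 ∉ innerSums l → T (ribbonCell l (0, 0) i) ≤ T (ribbonCell l (0, 0) (i + 1))) := by
  have hmem : ∀ i < l.sum, ribbonCell l (0, 0) i ∈ ribbonOfList l := fun i hi =>
    mem_ribbonAux.2 ⟨i, hi, rfl⟩
  constructor
  · rintro ⟨hrow, hcol⟩ i hi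
    refine ⟨fun hm => ?_, fun hm => ?_⟩
    · have hstep := (ribbonCell_succ hl (p := (0, 0)) hi).1 hm
      have hback : ((ribbonCell l (0, 0) (i + 1)).1 + 1, (ribbonCell l (0, 0) (i + 1)).2) =
          ribbonCell l (0, 0) i := by
        rw [hstep]; simp
      have := hcol _ (hmem _ hi)
      rw [hback] at this
      exact this (hmem _ (by omega))
    · have hstep := (ribbonCell_succ hl (p := (0, 0)) hi).2 hm
      have := hrow _ (hmem i (by omega))
      rw [← hstep] at this
      exact this (hmem _ hi)
  · intro h
    refine ⟨fun c hc hc' => ?_, fun c hc hc' => ?_⟩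
    all_goals
      obtain ⟨i, hi, rfl⟩ := mem_ribbonAux.1 hc
      obtain ⟨j, hj, hji⟩ := mem_ribbonAux.1 hc'
      have h1 := content_ribbonCell (p := (0, 0)) hi
      have h2 := content_ribbonCell (p := (0, 0)) hj
      rw [← hji]
      rw [Prod.ext_iff] at hji
      dsimp only at hji
    · obtain rfl : j = i + 1 := by omega
      refine (h i hj).2 fun hm => ?_
      rw [(ribbonCell_succ hl hj).1 hm] at hji
      dsimp only at hji
      omega
    · obtain rfl : i = j + 1 := by omega
      refine (h j hi).1 ?_
      by_contra hm
      rw [(ribbonCell_succ hl hi).2 hm] at hji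
      dsimp only at hji
      omega

theorem skewSchur_ribbon_eq_wordSeries {l : List ℕ} (hl : ∀ a ∈ l, 0 < a) :
    skewSchur (ribbonOfList l) = wordSeries {w | w.length = l.sum ∧ descents w = innerSums l} := by
  ext d
  change skewSchur _ d = wordSeries _ d
  rw [wordSeries_apply, skewSchur]
  congr 1
  let reading (T : ℤ × ℤ → ℕ) : List ℕ := List.ofFn fun i : Fin l.sum => T (ribbonCell l (0, 0) i)
  have hlen : ∀ T, (reading T).length = l.sum := fun T => by simp [reading]
  have hget : ∀ T, ∀ i < l.sum, (reading T).getD i 0 = T (ribbonCell l (0, 0) i) := by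
    intro T i hi
    simp [reading, hi]
  have hcells : ribbonOfList l = (range l.sum).image (ribbonCell l (0, 0)) := by
    ext c
    simp [ribbonOfList, mem_ribbonAux]
  have hweight : ∀ T, wordWeight (reading T) =
      ∑ c ∈ ribbonOfList l, Finsupp.single (T c) 1 := by
    intro T
    rw [hcells, sum_image (ribbonCell_injOn l _), sum_range, wordWeight, List.map_ofFn,
      List.sum_ofFn]
    rfl
  have hiff : ∀ T, ((∀ c ∈ ribbonOfList l, (c.1, c.2 + 1) ∈ ribbonOfList l →
        T c ≤ T (c.1, c.2 + 1)) ∧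
      (∀ c ∈ ribbonOfList l, (c.1 + 1, c.2) ∈ ribbonOfList l → T c < T (c.1 + 1, c.2))) ↔
      descents (reading T) = innerSums l := by
    intro T
    rw [ribbon_semistandard_iff hl, descents_eq_iff fun m hm => by
      rw [hlen]; exact innerSums_bounds hl hm, hlen]
    refine forall₂_congr fun i hi => ?_
    rw [hget T _ hi, hget T i (by omega)]
  refine Set.ncard_congr (fun T _ => reading T) ?_ ?_ ?_
  · rintro T ⟨-, h1, h2, h3⟩
    exact ⟨⟨hlen T, (hiff T).1 ⟨h1, h2⟩⟩, (hweight T).trans h3⟩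
  · rintro T U ⟨hT, -⟩ ⟨hU, -⟩ h
    funext c
    by_cases hc : c ∈ ribbonOfList l
    · obtain ⟨i, hi, rfl⟩ := mem_ribbonAux.1 hc
      rw [← hget T i hi, ← hget U i hi]
      exact congrArg (fun w => List.getD w i 0) h
    · rw [hT c hc, hU c hc]
  · rintro w ⟨⟨hwl, hwd⟩, hww⟩
    let T : ℤ × ℤ → ℕ := fun c => if c ∈ ribbonOfList l then w.getD (c.2 - c.1).toNat 0 else 0
    have hT : reading T = w := by
      refine List.ext_getElem ((hlen T).trans hwl.symm) fun i h1 h2 => ?_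
      have hi : i < l.sum := hwl ▸ h2
      rw [← List.getD_eq_getElem _ 0, ← List.getD_eq_getElem _ 0, hget T i hi]
      have hm : ribbonCell l (0, 0) i ∈ ribbonOfList l := mem_ribbonAux.2 ⟨i, hi, rfl⟩
      simp only [T, if_pos hm, content_ribbonCell hi]
      simp
    have h12 := (hiff T).2 (hT ▸ hwd)
    exact ⟨T, ⟨fun c hc => if_neg hc, h12.1, h12.2, by rw [← hweight, hT, hww]⟩, hT⟩

theorem Finset.sum_Icc_neg_one_pow_card_sub {ι : Type*} [DecidableEq ι] (D S : Finset ι) :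
    ∑ T ∈ Icc D S, (-1 : ℤ) ^ (#S - #T) = if D = S then 1 else 0 := by
  by_cases h : D ⊆ S
  · have hpow : ∑ T ∈ Icc D S, (-1 : ℤ) ^ (#S - #T) = ∑ U ∈ (S \ D).powerset, (-1) ^ #U := by
      refine sum_bij' (fun T _ => S \ T) (fun U _ => S \ U) ?_ ?_ ?_ ?_ ?_
      · intro T hT
        rw [mem_powerset]
        exact sdiff_subset_sdiff subset_rfl (mem_Icc.1 hT).1
      · intro U hU
        rw [mem_powerset] at hU
        rw [mem_Icc]
        refine ⟨fun x hx => mem_sdiff.2 ⟨h hx, fun hxU => ?_⟩, sdiff_subset⟩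
        exact (mem_sdiff.1 (hU hxU)).2 hx
      · intro T hT
        exact sdiff_sdiff_eq_self (mem_Icc.1 hT).2
      · intro U hU
        exact sdiff_sdiff_eq_self ((mem_powerset.1 hU).trans sdiff_subset)
      · intro T hT
        rw [card_sdiff_of_subset (mem_Icc.1 hT).2]
    rw [hpow, sum_powerset_neg_one_pow_card]
    refine if_congr ?_ rfl rfl
    rw [sdiff_eq_empty_iff_subset]
    exact ⟨fun h' => h.antisymm h', fun h' => h'.ge⟩
  · rw [Icc_eq_empty h, sum_empty, if_neg]
    rintro rfl
    exact h subset_rfl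

namespace Composition

theorem mem_boundaries_iff {n : ℕ} (β : Composition n) (x : Fin (n + 1)) :
    x ∈ β.boundaries ↔ x = 0 ∨ x = Fin.last n ∨ (x : ℕ) ∈ innerSums β.blocks := by
  simp only [boundaries, mem_map, mem_univ, true_and, RelEmbedding.coe_toEmbedding]
  constructor
  · rintro ⟨k, rfl⟩
    rcases Fin.eq_zero_or_eq_succ k with rfl | ⟨j, rfl⟩
    · exact .inl β.boundary_zero
    · by_cases hj : (j : ℕ) + 1 = β.length
      · right; left
        rw [← β.boundary_last]
        congr 1
        ext
        simpa using hj
      · right; right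
        exact ⟨j, by have := j.2; change _ < β.length; omega, rfl⟩
  · rintro (rfl | rfl | ⟨k, hk, hx⟩)
    · exact ⟨0, β.boundary_zero⟩
    · exact ⟨_, β.boundary_last⟩
    · exact ⟨⟨k + 1, by change k + 1 < β.length at hk; omega⟩, Fin.ext hx.symm⟩

theorem innerSums_blocks_bounds {n : ℕ} (β : Composition n) {m : ℕ}
    (hm : m ∈ innerSums β.blocks) : 0 < m ∧ m < n := by
  simpa [β.blocks_sum] using innerSums_bounds (fun a ha => β.blocks_pos ha) hm

open Classical in
theorem subset_innerSums_iff {n : ℕ} (β : Composition n) {D : Set ℕ}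
    (hD : ∀ m ∈ D, 0 < m ∧ m < n) :
    D ⊆ innerSums β.blocks ↔
      ({x | x = 0 ∨ x = Fin.last n ∨ (x : ℕ) ∈ D} : Finset (Fin (n + 1))) ⊆ β.boundaries := by
  constructor
  · intro h x hx
    rw [mem_filter_univ] at hx
    rw [mem_boundaries_iff]
    exact hx.imp_right (Or.imp_right fun hx => h hx)
  · intro h m hm
    obtain ⟨h0, hn⟩ := hD m hm
    have := h (x := ⟨m, by omega⟩) (by simp [hm])
    rw [mem_boundaries_iff] at this
    simpa [Fin.ext_iff, h0.ne', hn.ne] using this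

open Classical in
theorem eq_innerSums_iff {n : ℕ} (β : Composition n) {D : Set ℕ}
    (hD : ∀ m ∈ D, 0 < m ∧ m < n) :
    D = innerSums β.blocks ↔
      ({x | x = 0 ∨ x = Fin.last n ∨ (x : ℕ) ∈ D} : Finset (Fin (n + 1))) = β.boundaries := by
  constructor
  · rintro rfl
    ext x
    rw [mem_filter_univ, mem_boundaries_iff]
  · intro h
    refine ((β.subset_innerSums_iff hD).2 h.le).antisymm fun m hm => ?_
    obtain ⟨h0, hn⟩ := β.innerSums_blocks_bounds hm
    have hx : (⟨m, by omega⟩ : Fin (n + 1)) ∈ β.boundaries :=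
      (β.mem_boundaries_iff _).2 (.inr (.inr hm))
    rw [← h, mem_filter_univ] at hx
    simpa [Fin.ext_iff, h0.ne', hn.ne] using hx

theorem innerSums_subset_iff {n : ℕ} (β α : Composition n) :
    innerSums β.blocks ⊆ innerSums α.blocks ↔ β.boundaries ⊆ α.boundaries := by
  classical
  rw [α.subset_innerSums_iff fun _ => β.innerSums_blocks_bounds,
    ← (β.eq_innerSums_iff fun _ => β.innerSums_blocks_bounds).1 rfl]

open Classical in
theorem sum_neg_one_pow_length_sub {n : ℕ} (α : Composition n) {D : Set ℕ}
    (hD : ∀ m ∈ D, 0 < m ∧ m < n) :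
    ∑ β : Composition n with innerSums β.blocks ⊆ innerSums α.blocks ∧ D ⊆ innerSums β.blocks,
      (-1 : ℤ) ^ (α.length - β.length) = if D = innerSums α.blocks then 1 else 0 := by
  rw [if_congr (α.eq_innerSums_iff hD) rfl rfl, ← sum_Icc_neg_one_pow_card_sub]
  refine sum_bij (fun β _ => β.boundaries) ?_ ?_ ?_ ?_
  · intro β hβ
    rw [mem_filter_univ, innerSums_subset_iff, β.subset_innerSums_iff hD] at hβ
    exact mem_Icc.2 hβ.symm
  · intro β _ γ _ h
    exact (compositionEquiv n).injective (CompositionAsSet.ext h)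
  · intro T hT
    rw [mem_Icc] at hT
    have hb : ((compositionEquiv n).symm
        ⟨T, hT.1 (by simp), hT.1 (by simp)⟩).boundaries = T :=
      CompositionAsSet.toComposition_boundaries _
    refine ⟨_, ?_, hb⟩
    rw [mem_filter_univ, innerSums_subset_iff, subset_innerSums_iff _ hD, hb]
    exact hT.symm
  · intro β _
    rw [card_boundaries_eq_succ_length, card_boundaries_eq_succ_length, Nat.add_sub_add_right]

end Composition

end

/-- **MacMahon's formula.** For every composition `α` of a
positive integer `n`,
`r_α = Σ_{β ⪯ α} (-1)^{ℓ(α) - ℓ(β)} h_β`,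
summed over all compositions `β` of `n` coarser than `α` in the reverse
refinement order (i.e. with `S_β ⊆ S_α`). -/
theorem statement3 (n : ℕ) (hn : 0 < n) (α : Composition n) :
    skewSchur (ribbonOfList α.blocks) =
      ∑ᶠ (β : Composition n) (_ : innerSums β.blocks ⊆ innerSums α.blocks),
        (-1 : ℤ) ^ (α.length - β.length) • hComp β.blocks := by
  classical
  rw [finsum_eq_sum_of_fintype]
  simp_rw [finsum_eq_if]
  rw [← Finset.sum_filter, skewSchur_ribbon_eq_wordSeries fun a ha => α.blocks_pos ha, α.blocks_sum]
  have hβ (β : Composition n) : hComp β.blocks =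
      wordSeries {w | w.length = n ∧ descents w ⊆ innerSums β.blocks} := by
    rw [hComp_eq_wordSeries fun a ha => β.blocks_pos ha, β.blocks_sum]
  simp_rw [hβ]
  ext d
  simp only [map_sum, map_zsmul, smul_eq_mul]
  simp only [MvPowerSeries.coeff_apply, wordSeries, Finset.card_filter, Nat.cast_sum,
    Finset.mul_sum]
  rw [Finset.sum_comm]
  refine Finset.sum_congr rfl fun w _ => ?_
  by_cases hw : w.length = n
  · have hD : ∀ m ∈ descents w, 0 < m ∧ m < n := by
      rintro _ ⟨i, rfl, hi, -⟩
      omega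
    have := α.sum_neg_one_pow_length_sub hD
    rw [← Finset.filter_filter, Finset.sum_filter] at this
    simpa [hw] using this.symm
  · simp [hw]
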